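/- arXiv:2011.12653 — 11 statements merged into one kernel-verified Lean document; each statement's English description precedes it below -/
import Mathlib

section
/- Let A be a Banach algebra, X a Banach A-bimodule, and D : A × A → X a biderivation. Then D(a,b)·(c d − d c) = (a b − b a)·D(c,d) for all a, b, c, d ∈ A. -/
noncomputable section

universe u v

/-- A Banach `A`-bimodule: a Banach space `X` with continuous (bounded bilinear) left and
right `A`-actions satisfying `(a·x)·b = a·(x·b)`.  Here `l a x = a·x` and `r a x = x·a`. -/
structure BanachBimodule (A : Type u) (X : Type v) [NonUnitalNormedRing A]
    [NormedSpace ℂ A] [NormedAddCommGroup X] [NormedSpace ℂ X] : Type (max u v) where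
  l : A →L[ℂ] X →L[ℂ] X
  r : A →L[ℂ] X →L[ℂ] X
  l_mul : ∀ a b x, l (a * b) x = l a (l b x)
  r_mul : ∀ a b x, r (a * b) x = r b (r a x)
  lr_assoc : ∀ a b x, r b (l a x) = l a (r b x)

namespace BanachBimodule

variable {A : Type u} {X : Type v} [NonUnitalNormedRing A] [NormedSpace ℂ A]
  [NormedAddCommGroup X] [NormedSpace ℂ X]

/-- The dual Banach `A`-bimodule structure on `X* = X →L[ℂ] ℂ`, with
`(a·f)(x) = f(x·a)` and `(f·a)(x) = f(a·x)`. -/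
def dual (M : BanachBimodule A X) : BanachBimodule A (X →L[ℂ] ℂ) where
  l := (ContinuousLinearMap.compL ℂ X X ℂ).flip.comp M.r
  r := (ContinuousLinearMap.compL ℂ X X ℂ).flip.comp M.l
  l_mul := by
    intro a b f
    ext x
    simp [M.r_mul]
  r_mul := by
    intro a b f
    ext x
    simp [M.l_mul]
  lr_assoc := by
    intro a b f
    ext x
    simp [M.lr_assoc]

/-- `Z(A, X)`: the set of elements of `X` commuting with every element of `A`. -/
def center (M : BanachBimodule A X) : Set X := {x | ∀ a : A, M.l a x = M.r a x}

end BanachBimodule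

/-- A biderivation `D : A × A → X`: a bounded bilinear map which is a derivation in each
variable: `D(ac, b) = a·D(c,b) + D(a,b)·c` and `D(a, bc) = b·D(a,c) + D(a,b)·c`. -/
def IsBiderivation {A : Type u} {X : Type v} [NonUnitalNormedRing A] [NormedSpace ℂ A]
    [NormedAddCommGroup X] [NormedSpace ℂ X] (M : BanachBimodule A X)
    (D : A →L[ℂ] A →L[ℂ] X) : Prop :=
  (∀ a b c : A, D (a * c) b = M.l a (D c b) + M.r c (D a b)) ∧
  (∀ a b c : A, D a (b * c) = M.l b (D a c) + M.r c (D a b))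

/-- An inner biderivation: `Δ_x (a, b) = x·(ab - ba)` for some `x ∈ Z(A, X)`. -/
def IsInnerBiderivation {A : Type u} {X : Type v} [NonUnitalNormedRing A] [NormedSpace ℂ A]
    [NormedAddCommGroup X] [NormedSpace ℂ X] (M : BanachBimodule A X)
    (D : A →L[ℂ] A →L[ℂ] X) : Prop :=
  ∃ x ∈ M.center, ∀ a b : A, D a b = M.r (a * b - b * a) x

/-- A Banach algebra `A` is biamenable if for every Banach `A`-bimodule `X`, every
biderivation from `A × A` into the dual module `X*` is inner. -/
def Biamenable (A : Type u) [NonUnitalNormedRing A] [NormedSpace ℂ A]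
    [IsScalarTower ℂ A A] [SMulCommClass ℂ A A] [CompleteSpace A] : Prop :=
  ∀ (X : Type v) [NormedAddCommGroup X] [NormedSpace ℂ X] [CompleteSpace X]
    (M : BanachBimodule A X) (D : A →L[ℂ] A →L[ℂ] (X →L[ℂ] ℂ)),
    IsBiderivation M.dual D → IsInnerBiderivation M.dual D

/-- For every biderivation `D : A × A → X` on a Banach algebra `A` with values
in a Banach `A`-bimodule `X`, `D(a,b)·(cd - dc) = (ab - ba)·D(c,d)`. -/
theorem biderivation_commutator_identity {A : Type u} {X : Type v}
    [NonUnitalNormedRing A] [NormedSpace ℂ A] [IsScalarTower ℂ A A] [SMulCommClass ℂ A A]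
    [CompleteSpace A] [NormedAddCommGroup X] [NormedSpace ℂ X] [CompleteSpace X]
    (M : BanachBimodule A X) (D : A →L[ℂ] A →L[ℂ] X) (hD : IsBiderivation M D) :
    ∀ a b c d : A, M.r (c * d - d * c) (D a b) = M.l (a * b - b * a) (D c d) := by
  intro a b c d
  obtain ⟨h1, h2⟩ := hD
  have e1 := h1 a (b * d) c
  have e2 := h2 (a * c) b d
  rw [e1] at e2
  simp only [h1, h2, map_add, M.lr_assoc, ← M.l_mul, ← M.r_mul] at e2
  simp only [map_sub, ContinuousLinearMap.sub_apply]
  rw [sub_eq_sub_iff_add_eq_add]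
  rw [← sub_eq_zero] at e2 ⊢
  rw [← neg_eq_zero, ← e2]
  abel
end
end

section
/- Let A be a Banach algebra possessing a bounded left approximate identity (a bounded net (e_α) in A with ‖e_α a − a‖ → 0 for every a ∈ A) and such that span{a b − b a : a, b ∈ A} is dense in A. Let X be a Banach A-bimodule whose right action is trivial, i.e. x·a = 0 for all x ∈ X and a ∈ A. Then every biderivation D : A × A → X is identically zero. -/
noncomputable section

universe u v

/-- if `A` has a bounded left approximate identity and the span of commutators
is dense in `A`, then for any Banach `A`-bimodule `X` with trivial right action every
biderivation `D : A × A → X` vanishes. -/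
theorem biderivation_eq_zero_of_triv_right_action {A : Type u} {X : Type v}
    [NonUnitalNormedRing A] [NormedSpace ℂ A] [IsScalarTower ℂ A A] [SMulCommClass ℂ A A]
    [CompleteSpace A] [NormedAddCommGroup X] [NormedSpace ℂ X] [CompleteSpace X]
    -- a bounded left approximate identity: a bounded net `(e i)` with `e i * a → a` for all `a`
    (hbai : ∃ (ι : Type u) (F : Filter ι) (e : ι → A), F.NeBot ∧
      (∃ C : ℝ, ∀ i, ‖e i‖ ≤ C) ∧
      ∀ a : A, Filter.Tendsto (fun i => e i * a) F (nhds a))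
    -- the linear span of commutators is dense in `A`
    (hspan : Dense ((Submodule.span ℂ {x : A | ∃ a b : A, x = a * b - b * a} : Submodule ℂ A) : Set A))
    (M : BanachBimodule A X)
    -- the right module action is trivial
    (htriv : ∀ (a : A) (x : X), M.r a x = 0)
    (D : A →L[ℂ] A →L[ℂ] X) (hD : IsBiderivation M D) :
    ∀ a b : A, D a b = 0 := by
  obtain ⟨ι, F, e, hF, -, he⟩ := hbai
  obtain ⟨h1, h2⟩ := hD
  simp only [htriv, add_zero] at h1 h2
  have key : ∀ a c d : A, M.l a (D c d) = 0 := by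
    intro a c d
    have hclosed : IsClosed {x : A | M.l x (D c d) = 0} :=
      isClosed_eq (by fun_prop) continuous_const
    have hsub : ((Submodule.span ℂ {x : A | ∃ a b : A, x = a * b - b * a} : Submodule ℂ A) :
        Set A) ⊆ {x : A | M.l x (D c d) = 0} := by
      intro x hx
      induction hx using Submodule.span_induction with
      | mem x hx =>
        obtain ⟨a, b, rfl⟩ := hx
        have e1 : D (a * c) (b * d) = M.l (a * b) (D c d) := by
          rw [h1, h2, M.l_mul]
        have e2 : D (a * c) (b * d) = M.l (b * a) (D c d) := by
          rw [h2, h1, M.l_mul]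
        simp only [Set.mem_setOf_eq, map_sub, ContinuousLinearMap.sub_apply]
        rw [← e1, ← e2, sub_self]
      | zero => simp
      | add x y _ _ hx hy =>
        simp only [Set.mem_setOf_eq] at hx hy ⊢
        simp [hx, hy]
      | smul t x _ hx =>
        simp only [Set.mem_setOf_eq] at hx ⊢
        simp [hx]
    exact closure_minimal hsub hclosed (hspan a)
  intro a b
  have hc : Continuous fun x : A => D x b := by fun_prop
  have ht := (hc.tendsto a).comp (he a)
  refine tendsto_nhds_unique ht ?_
  simp [Function.comp_def, h1, key]
end
end

section
/- Let A be a unital Banach algebra with A = span{a b − b a : a, b ∈ A}, and let X be a unital Banach A-bimodule (i.e. 1·x = x = x·1 for all x ∈ X). Then every biderivation D : A × A → X is an inner biderivation: there exists λ ∈ Z(A, X) such that D(a, b) = λ·(a b − b a) for all a, b ∈ A. -/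
noncomputable section

universe u v

/-- if `A` is a unital Banach algebra spanned by its commutators and `X` is a
unital Banach `A`-bimodule, then every biderivation `D : A × A → X` is inner:
`D(a,b) = λ·(ab - ba)` for some `λ ∈ Z(A, X)`. -/
theorem biderivation_inner_of_unital_span_commutators {A : Type u} {X : Type v}
    [NormedRing A] [NormedAlgebra ℂ A] [CompleteSpace A]
    [NormedAddCommGroup X] [NormedSpace ℂ X] [CompleteSpace X]
    (hspan : Submodule.span ℂ {x : A | ∃ a b : A, x = a * b - b * a} = ⊤)
    (M : BanachBimodule A X)
    -- `X` is unital: `1·x = x = x·1`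
    (hunital : ∀ x : X, M.l 1 x = x ∧ M.r 1 x = x)
    (D : A →L[ℂ] A →L[ℂ] X) (hD : IsBiderivation M D) :
    ∃ lam ∈ M.center, ∀ a b : A, D a b = M.r (a * b - b * a) lam := by
  obtain ⟨h1, h2⟩ := hD
  have key : ∀ a b c d : A, M.l (a * b - b * a) (D c d) = M.r (c * d - d * c) (D a b) := by
    intro a b c d
    have e2 := (h1 a (b * d) c).symm.trans (h2 (a * c) b d)
    rw [h2 c, h2 a, h1 a d c, h1 a b c] at e2
    simp only [map_add, map_sub, ContinuousLinearMap.sub_apply, M.l_mul, M.r_mul,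
      M.lr_assoc] at e2 ⊢
    rw [sub_eq_sub_iff_add_eq_add, ← sub_eq_zero]
    rw [← sub_eq_zero] at e2
    rw [← e2]
    abel
  have ex : ∀ y ∈ Submodule.span ℂ {x : A | ∃ a b : A, x = a * b - b * a}, ∃ lam : X,
      ∀ c d : A, M.l y (D c d) = M.r (c * d - d * c) lam ∧
        M.l (c * d - d * c) lam = M.r y (D c d) := by
    intro y hy
    induction hy using Submodule.span_induction with
    | mem x hx =>
      obtain ⟨a, b, rfl⟩ := hx
      exact ⟨D a b, fun c d => ⟨key a b c d, key c d a b⟩⟩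
    | zero => exact ⟨0, fun c d => by simp⟩
    | add x y _ _ hx hy =>
      obtain ⟨p, hp⟩ := hx
      obtain ⟨q, hq⟩ := hy
      refine ⟨p + q, fun c d => ⟨?_, ?_⟩⟩
      · rw [map_add, map_add, ContinuousLinearMap.add_apply, (hp c d).1, (hq c d).1]
      · rw [map_add, map_add, ContinuousLinearMap.add_apply, (hp c d).2, (hq c d).2]
    | smul k x _ hx =>
      obtain ⟨p, hp⟩ := hx
      refine ⟨k • p, fun c d => ⟨?_, ?_⟩⟩
      · rw [map_smul, map_smul, ContinuousLinearMap.smul_apply, (hp c d).1]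
      · rw [map_smul, map_smul, ContinuousLinearMap.smul_apply, (hp c d).2]
  obtain ⟨lam, hlam⟩ := ex 1 (hspan ▸ Submodule.mem_top)
  refine ⟨lam, ?_, fun a b => by rw [← (hlam a b).1, (hunital _).1]⟩
  intro y
  have hy : y ∈ Submodule.span ℂ {x : A | ∃ a b : A, x = a * b - b * a} :=
    hspan ▸ Submodule.mem_top
  induction hy using Submodule.span_induction with
  | mem x hx =>
    obtain ⟨a, b, rfl⟩ := hx
    rw [(hlam a b).2, ← (hlam a b).1, (hunital _).1, (hunital _).2]
  | zero => simp
  | add x y _ _ hx hy =>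
    rw [map_add, map_add, ContinuousLinearMap.add_apply, ContinuousLinearMap.add_apply, hx, hy]
  | smul k x _ hx =>
    rw [map_smul, map_smul, ContinuousLinearMap.smul_apply, ContinuousLinearMap.smul_apply, hx]
end
end

section
/- Every unital Banach algebra A satisfying A = span{a b − b a : a, b ∈ A} is biamenable. -/
noncomputable section

universe u v

theorem biderivation_inner_aux {A : Type u} {X : Type v} [NormedRing A] [NormedAlgebra ℂ A]
    [NormedAddCommGroup X] [NormedSpace ℂ X]
    (hspan : Submodule.span ℂ {x : A | ∃ a b : A, x = a * b - b * a} = ⊤)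
    (M : BanachBimodule A X) (D : A →L[ℂ] A →L[ℂ] X) (hD : IsBiderivation M D) :
    IsInnerBiderivation M D := by
  obtain ⟨h1, h2⟩ := hD
  have key : ∀ a b c d : A, M.l (a * b - b * a) (D c d) = M.r (c * d - d * c) (D a b) := by
    intro a b c d
    have e1 := h1 a (b * d) c
    have e2 := h2 (a * c) b d
    rw [h2 c b d, h2 a b d] at e1
    rw [h1 a d c, h1 a b c] at e2
    rw [e1] at e2
    simp only [map_add, M.lr_assoc, ← M.l_mul, ← M.r_mul] at e2
    simp only [map_sub, ContinuousLinearMap.sub_apply]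
    rw [sub_eq_sub_iff_add_eq_add]
    have e3 := sub_eq_zero.mpr e2
    rw [← sub_eq_zero, ← e3]
    abel
  have ind : ∀ p : A → Prop, (∀ a b, p (a * b - b * a)) → p 0 → (∀ x y, p x → p y → p (x + y)) →
      (∀ (k : ℂ) x, p x → p (k • x)) → ∀ t, p t := by
    intro p hc h0 ha hs t
    have ht : t ∈ Submodule.span ℂ {x : A | ∃ a b : A, x = a * b - b * a} := by
      rw [hspan]; trivial
    induction ht using Submodule.span_induction with
    | mem x hx => obtain ⟨a, b, rfl⟩ := hx; exact hc a b
    | zero => exact h0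
    | add x y _ _ hx hy => exact ha x y hx hy
    | smul k x _ hx => exact hs k x hx
  have hl : ∀ t d : A, M.l t (D 1 d) = 0 := by
    intro t d
    refine ind (fun t => M.l t (D 1 d) = 0) ?_ ?_ ?_ ?_ t
    · intro a b
      simp only [key, one_mul, mul_one, sub_self, map_zero, ContinuousLinearMap.zero_apply]
    · simp
    · intro x y hx hy
      simp [hx, hy]
    · intro k x hx
      simp [hx]
  have hr : ∀ t d : A, M.r t (D 1 d) = 0 := by
    intro t d
    refine ind (fun t => M.r t (D 1 d) = 0) ?_ ?_ ?_ ?_ t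
    · intro a b
      simp only [← key, one_mul, mul_one, sub_self, map_zero, ContinuousLinearMap.zero_apply]
    · simp
    · intro x y hx hy
      simp [hx, hy]
    · intro k x hx
      simp [hx]
  have hu1 : ∀ a b, M.l 1 (D a b) = D a b := by
    intro a b
    have := h1 1 b a
    rw [hr, one_mul, add_zero] at this
    exact this.symm
  have hu2 : ∀ a b, M.r 1 (D a b) = D a b := by
    intro a b
    have := h1 a b 1
    rw [hl, mul_one, zero_add] at this
    exact this.symm
  have ex : ∀ t : A, ∃ x : X, ∀ c d : A, M.l t (D c d) = M.r (c * d - d * c) x ∧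
      M.r t (D c d) = M.l (c * d - d * c) x := by
    refine ind _ ?_ ?_ ?_ ?_
    · intro a b
      exact ⟨D a b, fun c d => ⟨key a b c d, (key c d a b).symm⟩⟩
    · exact ⟨0, by simp⟩
    · rintro s t ⟨x, hx⟩ ⟨y, hy⟩
      refine ⟨x + y, fun c d => ⟨?_, ?_⟩⟩
      · rw [map_add, map_add, ContinuousLinearMap.add_apply, (hx c d).1, (hy c d).1]
      · rw [map_add, map_add, ContinuousLinearMap.add_apply, (hx c d).2, (hy c d).2]
    · rintro k t ⟨x, hx⟩
      refine ⟨k • x, fun c d => ⟨?_, ?_⟩⟩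
      · rw [map_smul, map_smul, ContinuousLinearMap.smul_apply, (hx c d).1]
      · rw [map_smul, map_smul, ContinuousLinearMap.smul_apply, (hx c d).2]
  obtain ⟨x, hx⟩ := ex 1
  refine ⟨x, ?_, fun a b => by rw [← (hx a b).1, hu1]⟩
  intro t
  refine ind (fun t => M.l t x = M.r t x) ?_ ?_ ?_ ?_ t
  · intro a b
    rw [← (hx a b).1, ← (hx a b).2, hu1, hu2]
  · simp
  · intro s t hs ht
    rw [map_add, map_add, ContinuousLinearMap.add_apply, ContinuousLinearMap.add_apply, hs, ht]
  · intro k s hs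
    rw [map_smul, map_smul, ContinuousLinearMap.smul_apply, ContinuousLinearMap.smul_apply, hs]

/-- every unital Banach algebra spanned by its commutators is biamenable. -/
theorem biamenable_of_unital_span_commutators {A : Type u}
    [NormedRing A] [NormedAlgebra ℂ A] [CompleteSpace A]
    (hspan : Submodule.span ℂ {x : A | ∃ a b : A, x = a * b - b * a} = ⊤) :
    Biamenable.{u, v} A := by
  intro X _ _ _ M D hD
  exact biderivation_inner_aux hspan M.dual D hD
end
end

section
/- Let A be a unital Banach algebra with A = span{a b − b a : a, b ∈ A}. Then the only biderivation D : A × A → A* (where A* carries the dual bimodule actions) is the zero map. -/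
noncomputable section

universe u v

/-- The regular Banach `A`-bimodule structure of `A` on itself: `l a x = a * x`, `r a x = x * a`. -/
def BanachBimodule.regular (A : Type u) [NonUnitalNormedRing A] [NormedSpace ℂ A]
    [IsScalarTower ℂ A A] [SMulCommClass ℂ A A] : BanachBimodule A A where
  l := ContinuousLinearMap.mul ℂ A
  r := (ContinuousLinearMap.mul ℂ A).flip
  l_mul := by intro a b x; simp [mul_assoc]
  r_mul := by intro a b x; simp [mul_assoc]
  lr_assoc := by intro a b x; simp [mul_assoc]

/-- if `A` is a unital Banach algebra spanned by its commutators, then the only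
biderivation `D : A × A → A*` (with `A*` the dual bimodule of the regular bimodule `A`)
is the zero map. -/
theorem biderivation_into_dual_eq_zero {A : Type u}
    [NormedRing A] [NormedAlgebra ℂ A] [CompleteSpace A]
    (hspan : Submodule.span ℂ {x : A | ∃ a b : A, x = a * b - b * a} = ⊤)
    (D : A →L[ℂ] A →L[ℂ] (A →L[ℂ] ℂ))
    (hD : IsBiderivation (BanachBimodule.regular A).dual D) :
    D = 0 := by
  obtain ⟨h1, h2⟩ := hD
  have h1' : ∀ a b c x : A, D (a * c) b x = D c b (x * a) + D a b (c * x) := by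
    intro a b c x
    rw [h1]
    simp [BanachBimodule.dual, BanachBimodule.regular]
  have h2' : ∀ a b c x : A, D a (b * c) x = D a c (x * b) + D a b (c * x) := by
    intro a b c x
    rw [h2]
    simp [BanachBimodule.dual, BanachBimodule.regular]
  have H : ∀ a b c d x : A,
      D c d (x * (a * b - b * a)) = D a b ((c * d - d * c) * x) := by
    intro a b c d x
    have e1 := h1' a (b * d) c x
    have e2 := h2' (a * c) b d x
    rw [e1, h2' c, h2' a, h1' a d, h1' a b] at e2
    simp only [mul_sub, sub_mul, map_sub, mul_assoc] at e2 ⊢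
    linear_combination e2
  have ind : ∀ P : A → Prop, (∀ a b, P (a * b - b * a)) → P 0 →
      (∀ x y, P x → P y → P (x + y)) → (∀ (k : ℂ) x, P x → P (k • x)) → ∀ u, P u := by
    intro P hc h0 ha hs u
    have hu : u ∈ Submodule.span ℂ {x : A | ∃ a b : A, x = a * b - b * a} := by
      rw [hspan]; trivial
    induction hu using Submodule.span_induction with
    | mem x hx => obtain ⟨a, b, rfl⟩ := hx; exact hc a b
    | zero => exact h0
    | add x y _ _ hx hy => exact ha x y hx hy
    | smul k x _ hx => exact hs k x hx
  have key : ∀ u : A, ∃ F : A →L[ℂ] ℂ, ∀ a b x : A,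
      F (x * (a * b - b * a)) = D a b (u * x) ∧ F ((a * b - b * a) * x) = D a b (x * u) := by
    apply ind
    · intro c d
      exact ⟨D c d, fun a b x => ⟨H a b c d x, (H c d a b x).symm⟩⟩
    · exact ⟨0, fun a b x => by simp⟩
    · rintro u v ⟨F, hF⟩ ⟨G, hG⟩
      refine ⟨F + G, fun a b x => ?_⟩
      rw [ContinuousLinearMap.add_apply, ContinuousLinearMap.add_apply, (hF a b x).1,
        (hF a b x).2, (hG a b x).1, (hG a b x).2]
      simp [add_mul, mul_add]
    · rintro k u ⟨F, hF⟩
      refine ⟨k • F, fun a b x => ?_⟩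
      rw [ContinuousLinearMap.smul_apply, ContinuousLinearMap.smul_apply, (hF a b x).1,
        (hF a b x).2]
      simp
  obtain ⟨F, hF⟩ := key 1
  have tr : ∀ a x : A, F (x * a) = F (a * x) := by
    apply ind
    · intro a b x
      rw [(hF a b x).1, (hF a b x).2]; simp
    · simp
    · intro a b ha hb x
      simp [mul_add, add_mul, ha x, hb x]
    · intro k a ha x
      simp [ha x]
  have F0 : ∀ a : A, F a = 0 := by
    apply ind
    · intro a b
      rw [map_sub, tr, sub_self]
    · simp
    · intro a b ha hb
      simp [ha, hb]
    · intro k a ha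
      simp [ha]
  ext a b x
  have := (hF a b x).1
  rw [F0, one_mul] at this
  simp [← this]
end
end

section
/- Let A be a Banach algebra whose character space σ(A) is nonempty. Then A is not biamenable. -/
noncomputable section

universe u v

/-- a Banach algebra admitting a character (a nonzero continuous multiplicative
linear functional) is not biamenable. -/
theorem not_biamenable_of_character {A : Type u}
    [NonUnitalNormedRing A] [NormedSpace ℂ A] [IsScalarTower ℂ A A] [SMulCommClass ℂ A A]
    [CompleteSpace A]
    (hchar : ∃ φ : A →L[ℂ] ℂ, φ ≠ 0 ∧ ∀ a b : A, φ (a * b) = φ a * φ b) :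
    ¬ Biamenable.{u, v} A := by
  obtain ⟨φ, hφ, hm⟩ := hchar
  intro h
  let ψ : ULift.{v} ℂ →L[ℂ] ℂ :=
    (ContinuousLinearEquiv.ulift : ULift.{v} ℂ ≃L[ℂ] ℂ).toContinuousLinearMap
  let M : BanachBimodule A (ULift.{v} ℂ) :=
    { l := φ.smulRight (ContinuousLinearMap.id ℂ (ULift.{v} ℂ))
      r := 0
      l_mul := by
        intro a b x
        simp [hm, mul_smul, smul_comm (φ a) (φ b) x]
      r_mul := by
        intro a b x
        simp
      lr_assoc := by
        intro a b x
        simp }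
  have hl : ∀ (a : A) (f : ULift.{v} ℂ →L[ℂ] ℂ), M.dual.l a f = 0 := by
    intro a f
    ext x
    simp [BanachBimodule.dual, M]
  have hr : ∀ (a : A) (f : ULift.{v} ℂ →L[ℂ] ℂ), M.dual.r a f = φ a • f := by
    intro a f
    ext x
    simp [BanachBimodule.dual, M]
  obtain ⟨x, -, hx⟩ := h (ULift.{v} ℂ) M (φ.smulRight (φ.smulRight ψ)) (by
    constructor
    · intro a b c
      rw [hl, hr]
      simp only [ContinuousLinearMap.smulRight_apply, ContinuousLinearMap.smul_apply, hm,
        smul_smul, zero_add]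
      congr 1
      ring
    · intro a b c
      rw [hl, hr]
      simp only [ContinuousLinearMap.smulRight_apply, ContinuousLinearMap.smul_apply, hm,
        smul_smul, zero_add]
      congr 1
      ring)
  apply hφ
  ext a
  have h1 := hx a a
  rw [sub_self, map_zero] at h1
  have h2 := congrArg (fun f : ULift.{v} ℂ →L[ℂ] ℂ => f (ULift.up 1)) h1
  have h3 : ψ (ULift.up 1) = 1 := rfl
  simpa [h3] using h2
end
end

section
/- For every infinite-dimensional complex Hilbert space H, the character space of the Banach algebra B(H) of bounded linear operators on H is empty; that is, there is no nonzero continuous multiplicative linear functional B(H) → ℂ. -/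
theorem exists_isom_aux {H : Type*} [NormedAddCommGroup H]
    [InnerProductSpace ℂ H] [CompleteSpace H] {ι : Type*} (b : HilbertBasis ι ℂ H)
    (f : ι → ι) (hf : Function.Injective f) :
    ∃ V : H →ₗᵢ[ℂ] H, ∀ i, V (b i) = b (f i) := by
  classical
  have hv : Orthonormal ℂ (fun i => b (f i)) := b.orthonormal.comp f hf
  refine ⟨hv.orthogonalFamily.linearIsometry.comp b.repr.toLinearIsometry, fun i => ?_⟩
  simp [HilbertBasis.repr_self, OrthogonalFamily.linearIsometry_apply_single]

/-- for an infinite-dimensional complex Hilbert space `H`, there is no nonzero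
continuous multiplicative linear functional on the Banach algebra `B(H) = H →L[ℂ] H`. -/
theorem no_character_on_bounded_operators (H : Type*) [NormedAddCommGroup H]
    [InnerProductSpace ℂ H] [CompleteSpace H] (hinf : ¬ FiniteDimensional ℂ H) :
    ¬ ∃ φ : (H →L[ℂ] H) →L[ℂ] ℂ, φ ≠ 0 ∧ ∀ f g : H →L[ℂ] H, φ (f * g) = φ f * φ g := by
  rintro ⟨φ, h0, hm⟩
  obtain ⟨w, b, -⟩ := exists_hilbertBasis ℂ H
  have hw : Infinite w := by
    by_contra h
    rw [not_infinite_iff_finite] at h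
    have := Fintype.ofFinite w
    exact hinf b.toOrthonormalBasis.toBasis.finiteDimensional_of_finite
  have hc : Cardinal.mk (w ⊕ w) = Cardinal.mk w := by
    rw [← Cardinal.add_def]
    exact Cardinal.add_eq_self (Cardinal.aleph0_le_mk w)
  obtain ⟨e⟩ := Cardinal.eq.1 hc
  obtain ⟨V, hV⟩ := exists_isom_aux b (fun i => e (Sum.inl i)) (e.injective.comp Sum.inl_injective)
  obtain ⟨W, hW⟩ := exists_isom_aux b (fun i => e (Sum.inr i)) (e.injective.comp Sum.inr_injective)
  have iso : ∀ U : H →ₗᵢ[ℂ] H, ContinuousLinearMap.adjoint U.toContinuousLinearMap *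
      U.toContinuousLinearMap = 1 := by
    intro U
    ext x
    refine ext_inner_left ℂ fun y => ?_
    simp [ContinuousLinearMap.adjoint_inner_right]
  have orth : ContinuousLinearMap.adjoint V.toContinuousLinearMap *
      W.toContinuousLinearMap = 0 := by
    refine ContinuousLinearMap.ext_on (s := Set.range b)
      (Submodule.dense_iff_topologicalClosure_eq_top.2 b.dense_span) ?_
    rintro _ ⟨j, rfl⟩
    apply b.repr.injective
    ext i
    rw [HilbertBasis.repr_apply_apply]
    simp [ContinuousLinearMap.adjoint_inner_right, hV, hW,
      b.orthonormal.inner_eq_zero (i := e (Sum.inl i)) (j := e (Sum.inr j)) (by simp)]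
  have h1 : φ 1 ≠ 0 := by
    intro h
    apply h0
    ext f
    have := hm f 1
    simpa [h] using this
  have d := hm (ContinuousLinearMap.adjoint V.toContinuousLinearMap) W.toContinuousLinearMap
  rw [orth, map_zero] at d
  rcases mul_eq_zero.1 d.symm with h | h
  · exact h1 (by rw [← iso V, hm, h, zero_mul])
  · exact h1 (by rw [← iso W, hm, h, mul_zero])
end

section
/- If A is a biamenable Banach algebra, then for every positive integer n, the linear span of {a₁ a₂ ⋯ aₙ : a₁, …, aₙ ∈ A} is dense in A. -/
noncomputable section

universe u v

/-- The product `f 0 * f 1 * ⋯ * f n` of `n + 1` elements (no unit required). -/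
def prodOfFn {A : Type u} [Mul A] : ∀ n : ℕ, (Fin (n + 1) → A) → A
  | 0, f => f 0
  | n + 1, f => prodOfFn n (fun i => f i.castSucc) * f (Fin.last (n + 1))

theorem dense_of_dual_zero {A : Type u} [NormedAddCommGroup A] [NormedSpace ℂ A]
    (S : Submodule ℂ A) (h : ∀ φ : A →L[ℂ] ℂ, (∀ x ∈ S, φ x = 0) → φ = 0) :
    Dense (S : Set A) := by
  rw [Submodule.dense_iff_topologicalClosure_eq_top, eq_top_iff]
  intro x _
  by_contra hx
  have hc : IsClosed (S.topologicalClosure : Set A) := S.isClosed_topologicalClosure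
  have : IsClosed (S.topologicalClosure.toAddSubgroup : Set A) := hc
  have hne : (S.topologicalClosure.mkQ x) ≠ 0 := by
    simpa [Submodule.Quotient.mk_eq_zero] using hx
  obtain ⟨f, hf⟩ := SeparatingDual.exists_ne_zero (R := ℂ) hne
  have := h (f.comp S.topologicalClosure.mkQL) (by
    intro y hy
    have : S.topologicalClosure.mkQ y = 0 := by
      simpa [Submodule.Quotient.mk_eq_zero] using S.le_topologicalClosure hy
    change f (S.topologicalClosure.mkQ y) = 0
    rw [this, map_zero])
  exact hf (DFunLike.congr_fun this x)

theorem biamenable_dual_zero {A : Type u}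
    [NonUnitalNormedRing A] [NormedSpace ℂ A] [IsScalarTower ℂ A A] [SMulCommClass ℂ A A]
    [CompleteSpace A] (hbi : Biamenable.{u, v} A) (φ : A →L[ℂ] ℂ)
    (h : ∀ a b, φ (a * b) = 0) : φ = 0 := by
  let e : ULift.{v} ℂ →L[ℂ] ℂ :=
    (ContinuousLinearEquiv.ulift : ULift.{v} ℂ ≃L[ℂ] ℂ).toContinuousLinearMap
  let M : BanachBimodule A (ULift.{v} ℂ) :=
    { l := 0, r := 0, l_mul := by simp, r_mul := by simp, lr_assoc := by simp }
  obtain ⟨x, -, hx⟩ := hbi (ULift.{v} ℂ) M (φ.smulRight (φ.smulRight e)) (by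
    constructor <;> intro a b c <;> ext y <;> simp [M, BanachBimodule.dual, h])
  ext a
  have := DFunLike.congr_fun (hx a a) (ULift.up 1)
  have h1 : (ULift.up 1 : ULift.{v} ℂ) ≠ 0 := fun h0 => one_ne_zero (congrArg ULift.down h0)
  simpa [M, BanachBimodule.dual, e, h1] using this

/-- if `A` is a biamenable Banach algebra, then for every positive integer `n`
(written `n + 1` below) the linear span of the set of products of `n` elements of `A`
is dense in `A`. -/
theorem dense_span_products_of_biamenable {A : Type u}
    [NonUnitalNormedRing A] [NormedSpace ℂ A] [IsScalarTower ℂ A A] [SMulCommClass ℂ A A]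
    [CompleteSpace A] (hbi : Biamenable.{u, v} A) :
    ∀ n : ℕ, Dense ((Submodule.span ℂ
      {x : A | ∃ f : Fin (n + 1) → A, x = prodOfFn n f} : Submodule ℂ A) : Set A) := by
  intro n
  induction n with
  | zero =>
    have : {x : A | ∃ f : Fin (0 + 1) → A, x = prodOfFn 0 f} = Set.univ := by
      ext x
      simp only [Set.mem_ofPred_eq, Set.mem_univ, iff_true]
      exact ⟨fun _ => x, rfl⟩
    rw [this]
    simp
  | succ n ih =>
    apply dense_of_dual_zero
    intro φ hφ
    apply biamenable_dual_zero hbi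
    intro a b
    have hcl : IsClosed {a : A | φ (a * b) = 0} :=
      isClosed_eq (by fun_prop) continuous_const
    refine (hcl.closure_subset_iff.2 ?_) (ih a)
    intro y hy
    simp only [Set.mem_ofPred_eq]
    induction hy using Submodule.span_induction with
    | mem y hy =>
      obtain ⟨f, rfl⟩ := hy
      apply hφ
      apply Submodule.subset_span
      refine ⟨Fin.snoc (α := fun _ => A) f b, ?_⟩
      simp [prodOfFn]
    | zero => simp
    | add x y _ _ hx hy => simp [add_mul, hx, hy]
    | smul c x _ hx => simp [smul_mul_assoc, hx]
end
end

section
/- Let θ : A → B be a continuous algebra homomorphism between Banach algebras with dense range. If A is biamenable, then B is biamenable. -/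
noncomputable section

universe u v

/-- if `θ : A → B` is a continuous algebra homomorphism with dense range and
`A` is biamenable, then so is `B`. -/
theorem biamenable_of_denseRange_hom {A : Type u} {B : Type w}
    [NonUnitalNormedRing A] [NormedSpace ℂ A] [IsScalarTower ℂ A A] [SMulCommClass ℂ A A]
    [CompleteSpace A]
    [NonUnitalNormedRing B] [NormedSpace ℂ B] [IsScalarTower ℂ B B] [SMulCommClass ℂ B B]
    [CompleteSpace B]
    (θ : A →L[ℂ] B) (hmul : ∀ a b : A, θ (a * b) = θ a * θ b) (hdense : DenseRange θ)
    (hbi : Biamenable.{u, v} A) : Biamenable.{w, v} B := by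
  intro X _ _ _ M D hD
  let N : BanachBimodule A X :=
    { l := M.l.comp θ
      r := M.r.comp θ
      l_mul := by intro a b x; simp [hmul, M.l_mul]
      r_mul := by intro a b x; simp [hmul, M.r_mul]
      lr_assoc := by intro a b x; simp [M.lr_assoc] }
  have hl : ∀ a f, N.dual.l a f = M.dual.l (θ a) f := fun a f => rfl
  have hr : ∀ a f, N.dual.r a f = M.dual.r (θ a) f := fun a f => rfl
  let E : A →L[ℂ] A →L[ℂ] (X →L[ℂ] ℂ) := D.bilinearComp θ θ
  have hE : ∀ a b, E a b = D (θ a) (θ b) := fun a b => rfl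
  have hEb : IsBiderivation N.dual E := by
    refine ⟨fun a b c => ?_, fun a b c => ?_⟩
    · rw [hl, hr, hE, hE, hE, hmul]; exact hD.1 _ _ _
    · rw [hl, hr, hE, hE, hE, hmul]; exact hD.2 _ _ _
  obtain ⟨f, hf, hfE⟩ := hbi X N E hEb
  refine ⟨f, ?_, ?_⟩
  · intro b
    refine hdense.induction_on (p := fun b => M.dual.l b f = M.dual.r b f) b
      (isClosed_eq (by fun_prop) (by fun_prop)) (fun a => ?_)
    exact hf a
  · intro a b
    refine hdense.induction_on₂ (p := fun a b => D a b = M.dual.r (a * b - b * a) f)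
      (isClosed_eq (by fun_prop) (by fun_prop)) (fun a b => ?_) a b
    have h := hfE a b
    rw [hr, hE, map_sub, hmul, hmul] at h
    exact h
end
end

section
/- For every complex Banach algebra A, the unconditional unitization A♭ — the Banach algebra A ⊕ ℂ with product (a, λ)(b, μ) = (a b + λ b + μ a, λ μ) and norm ‖(a, λ)‖ = ‖a‖ + |λ| — is not biamenable. -/
noncomputable section

universe u v

/-- The canonical character of the unitization. -/
def unitChar (A : Type u)
    [NonUnitalNormedRing A] [NormedSpace ℂ A] [IsScalarTower ℂ A A] [SMulCommClass ℂ A A] :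
    WithLp 1 (Unitization ℂ A) →L[ℂ] ℂ :=
  LinearMap.mkContinuous
    { toFun := fun x => (WithLp.ofLp x).fst
      map_add' := fun x y => by simp
      map_smul' := fun c x => by simp } 1 (fun x => by
        rw [WithLp.unitization_norm_def]
        change ‖(WithLp.ofLp x).fst‖ ≤ 1 * (‖(WithLp.ofLp x).fst‖ + ‖(WithLp.ofLp x).snd‖)
        linarith [norm_nonneg (WithLp.ofLp x).snd])

lemma unitChar_apply (A : Type u)
    [NonUnitalNormedRing A] [NormedSpace ℂ A] [IsScalarTower ℂ A A] [SMulCommClass ℂ A A]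
    (x : WithLp 1 (Unitization ℂ A)) : unitChar A x = (WithLp.ofLp x).fst := rfl

lemma unitChar_mul (A : Type u)
    [NonUnitalNormedRing A] [NormedSpace ℂ A] [IsScalarTower ℂ A A] [SMulCommClass ℂ A A]
    (x y : WithLp 1 (Unitization ℂ A)) :
    unitChar A (x * y) = unitChar A x * unitChar A y := by
  simp [unitChar_apply]

lemma unitChar_one (A : Type u)
    [NonUnitalNormedRing A] [NormedSpace ℂ A] [IsScalarTower ℂ A A] [SMulCommClass ℂ A A] :
    unitChar A 1 = 1 := by
  rfl

/-- The one-dimensional module with left action by the character and zero right action. -/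
def charModule (A : Type u)
    [NonUnitalNormedRing A] [NormedSpace ℂ A] [IsScalarTower ℂ A A] [SMulCommClass ℂ A A] :
    BanachBimodule (WithLp 1 (Unitization ℂ A)) (ULift.{v} ℂ) where
  l := (unitChar A).smulRight (ContinuousLinearMap.id ℂ (ULift.{v} ℂ))
  r := 0
  l_mul := by
    intro a b x
    simp [unitChar_mul, mul_smul]
    exact smul_comm _ _ _
  r_mul := by simp
  lr_assoc := by simp

/-- the unconditional unitization `A♭ = A ⊕ ℂ` (with product
`(a, λ)(b, μ) = (ab + λb + μa, λμ)` and the ℓ¹-norm `‖(a, λ)‖ = ‖a‖ + |λ|`, realized in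
Mathlib as `WithLp 1 (Unitization ℂ A)`) of a complex Banach algebra `A` is never
biamenable. -/
theorem unitization_not_biamenable (A : Type u)
    [NonUnitalNormedRing A] [NormedSpace ℂ A] [IsScalarTower ℂ A A] [SMulCommClass ℂ A A]
    [CompleteSpace A] :
    ¬ Biamenable.{u, v} (WithLp 1 (Unitization ℂ A)) := by
  intro h
  let z : ULift.{v} ℂ →L[ℂ] ℂ := (ContinuousLinearEquiv.ulift : ULift.{v} ℂ ≃L[ℂ] ℂ)
  have key := h (ULift.{v} ℂ) (charModule A)
    ((unitChar A).smulRight ((unitChar A).smulRight z)) (by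
      constructor
      · intro a b c
        ext x
        simp [charModule, BanachBimodule.dual, unitChar_mul]
        ring
      · intro a b c
        ext x
        simp [charModule, BanachBimodule.dual, unitChar_mul]
        grind)
  obtain ⟨x, -, hx⟩ := key
  have h1 := congrArg (fun f => f (ULift.up 1)) (hx 1 1)
  simp [unitChar_one, z] at h1
  exact one_ne_zero (congrArg ULift.down h1)
end
end

section
/- Let A and B be Banach algebras, X a Banach A–B-bimodule, and D : A × B → X a biderivation. Then for all a, c ∈ A and b, d ∈ B: a·(b·D(c,d)) − b·(a·D(c,d)) = (D(a,b)·c)·d − (D(a,b)·d)·c, where · denotes the respective left and right A- and B-actions on X. -/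
noncomputable section

universe u v

universe w

/-- A Banach `A-B`-bimodule: a Banach space which is both a Banach `A`-bimodule and a
Banach `B`-bimodule such that `a·(x·b) = (a·x)·b` and `b·(x·a) = (b·x)·a`. -/
structure BanachBimodulePair (A : Type u) (B : Type w) (X : Type v)
    [NonUnitalNormedRing A] [NormedSpace ℂ A] [NonUnitalNormedRing B] [NormedSpace ℂ B]
    [NormedAddCommGroup X] [NormedSpace ℂ X] : Type (max u w v) where
  mA : BanachBimodule A X
  mB : BanachBimodule B X
  compat₁ : ∀ (a : A) (b : B) (x : X), mA.l a (mB.r b x) = mB.r b (mA.l a x)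
  compat₂ : ∀ (a : A) (b : B) (x : X), mB.l b (mA.r a x) = mA.r a (mB.l b x)

namespace BanachBimodulePair

variable {A : Type u} {B : Type w} {X : Type v}
  [NonUnitalNormedRing A] [NormedSpace ℂ A] [NonUnitalNormedRing B] [NormedSpace ℂ B]
  [NormedAddCommGroup X] [NormedSpace ℂ X]

/-- The dual Banach `A-B`-bimodule structure on `X*`. -/
def dual (P : BanachBimodulePair A B X) : BanachBimodulePair A B (X →L[ℂ] ℂ) where
  mA := P.mA.dual
  mB := P.mB.dual
  compat₁ := by
    intro a b f
    ext x
    simp [BanachBimodule.dual, P.compat₂]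
  compat₂ := by
    intro a b f
    ext x
    simp [BanachBimodule.dual, P.compat₁]

/-- `Z(A, X) ∩ Z(B, X)` for an `A-B`-bimodule. -/
def center (P : BanachBimodulePair A B X) : Set X :=
  {x | (∀ a : A, P.mA.l a x = P.mA.r a x) ∧ (∀ b : B, P.mB.l b x = P.mB.r b x)}

end BanachBimodulePair

/-- A biderivation `D : A × B → X`: a bounded bilinear map which is a derivation in each
variable. -/
def IsPairBiderivation {A : Type u} {B : Type w} {X : Type v}
    [NonUnitalNormedRing A] [NormedSpace ℂ A] [NonUnitalNormedRing B] [NormedSpace ℂ B]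
    [NormedAddCommGroup X] [NormedSpace ℂ X] (P : BanachBimodulePair A B X)
    (D : A →L[ℂ] B →L[ℂ] X) : Prop :=
  (∀ (a a' : A) (b : B), D (a * a') b = P.mA.l a (D a' b) + P.mA.r a' (D a b)) ∧
  (∀ (a : A) (b b' : B), D a (b * b') = P.mB.l b (D a b') + P.mB.r b' (D a b))

/-- An inner biderivation `D_x(a, b) = (x·a)·b - (x·b)·a` for `x ∈ Z(A,X) ∩ Z(B,X)`. -/
def IsInnerPairBiderivation {A : Type u} {B : Type w} {X : Type v}
    [NonUnitalNormedRing A] [NormedSpace ℂ A] [NonUnitalNormedRing B] [NormedSpace ℂ B]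
    [NormedAddCommGroup X] [NormedSpace ℂ X] (P : BanachBimodulePair A B X)
    (D : A →L[ℂ] B →L[ℂ] X) : Prop :=
  ∃ x ∈ P.center, ∀ (a : A) (b : B),
    D a b = P.mB.r b (P.mA.r a x) - P.mA.r a (P.mB.r b x)

/-- The pair `(A, B)` of Banach algebras is biamenable if for every Banach `A-B`-bimodule
`X`, every biderivation from `A × B` into `X*` is inner. -/
def PairBiamenable (A : Type u) (B : Type w)
    [NonUnitalNormedRing A] [NormedSpace ℂ A] [IsScalarTower ℂ A A] [SMulCommClass ℂ A A]
    [CompleteSpace A]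
    [NonUnitalNormedRing B] [NormedSpace ℂ B] [IsScalarTower ℂ B B] [SMulCommClass ℂ B B]
    [CompleteSpace B] : Prop :=
  ∀ (X : Type v) [NormedAddCommGroup X] [NormedSpace ℂ X] [CompleteSpace X]
    (P : BanachBimodulePair A B X) (D : A →L[ℂ] B →L[ℂ] (X →L[ℂ] ℂ)),
    IsPairBiderivation P.dual D → IsInnerPairBiderivation P.dual D

/-- for every biderivation `D : A × B → X` into a Banach `A-B`-bimodule,
`a·(b·D(c,d)) - b·(a·D(c,d)) = (D(a,b)·c)·d - (D(a,b)·d)·c`. -/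
theorem pair_biderivation_commutator_identity {A : Type u} {B : Type w} {X : Type v}
    [NonUnitalNormedRing A] [NormedSpace ℂ A] [IsScalarTower ℂ A A] [SMulCommClass ℂ A A]
    [CompleteSpace A]
    [NonUnitalNormedRing B] [NormedSpace ℂ B] [IsScalarTower ℂ B B] [SMulCommClass ℂ B B]
    [CompleteSpace B]
    [NormedAddCommGroup X] [NormedSpace ℂ X] [CompleteSpace X]
    (P : BanachBimodulePair A B X) (D : A →L[ℂ] B →L[ℂ] X)
    (hD : IsPairBiderivation P D) :
    ∀ (a c : A) (b d : B),
      P.mA.l a (P.mB.l b (D c d)) - P.mB.l b (P.mA.l a (D c d)) =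
        P.mB.r d (P.mA.r c (D a b)) - P.mA.r c (P.mB.r d (D a b)) := by
  intro a c b d
  obtain ⟨h1, h2⟩ := hD
  have e1 : D (a * c) (b * d) = P.mA.l a (P.mB.l b (D c d)) + P.mA.l a (P.mB.r d (D c b))
      + (P.mA.r c (P.mB.l b (D a d)) + P.mA.r c (P.mB.r d (D a b))) := by
    rw [h1, h2, h2, map_add, map_add]
  have e2 : D (a * c) (b * d) = P.mB.l b (P.mA.l a (D c d)) + P.mB.l b (P.mA.r c (D a d))
      + (P.mB.r d (P.mA.l a (D c b)) + P.mB.r d (P.mA.r c (D a b))) := by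
    rw [h2, h1, h1, map_add, map_add]
  rw [e1, P.compat₁, ← P.compat₂] at e2
  rw [sub_eq_sub_iff_add_eq_add]
  have e3 := sub_eq_zero.mpr e2
  rw [← sub_eq_zero, ← e3]
  abel
end
end
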